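/- Let n ≥ 2 and let (k_i)_{i ∈ ZMod n} be natural numbers. Then the number of configurations K on ZMod n such that for every i ∈ ZMod n one has #{j ∈ ZMod n : {i,j} ∈ K} = k_i is at most 2^{k_0 + k_1 + ... + k_{n-1}}. -/

import Mathlib

open Finset

/-- The cyclic interval `[i,j]` in the circle set `ZMod n`: the set
`{i, i+1, ..., j}` obtained by repeatedly adding `1` starting from `i` until `j` is
reached (both endpoints included). -/
def cycInterval (n : ℕ) (i j : ZMod n) : Set (ZMod n) :=
  {x | ∃ m : ℕ, m ≤ (j - i).val ∧ x = i + (m : ZMod n)}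

/-- A configuration on the circle set `ZMod n`: a finite set of unordered pairs of
distinct elements such that any two pairs `{i,j}`, `{k,l}` of the configuration are
non-crossing, i.e. either `i, j ∈ [k,l]` or `i, j ∈ [l,k]`. -/
def IsConfiguration (n : ℕ) (K : Finset (Sym2 (ZMod n))) : Prop :=
  (∀ p ∈ K, ¬ p.IsDiag) ∧
  ∀ i j k l : ZMod n, s(i, j) ∈ K → s(k, l) ∈ K →
    (i ∈ cycInterval n k l ∧ j ∈ cycInterval n k l) ∨
    (i ∈ cycInterval n l k ∧ j ∈ cycInterval n l k)

/-- The neighbours of `i` in `K` whose representative is larger than that of `i`. -/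
def upNeighbors (n : ℕ) [NeZero n] (K : Finset (Sym2 (ZMod n))) (i : ZMod n) :
    Finset (ZMod n) :=
  univ.filter fun j => i.val < j.val ∧ s(i, j) ∈ K

/-- The neighbours of `i` in `K` whose representative is smaller than that of `i`. -/
def downNeighbors (n : ℕ) [NeZero n] (K : Finset (Sym2 (ZMod n))) (i : ZMod n) :
    Finset (ZMod n) :=
  univ.filter fun j => j.val < i.val ∧ s(i, j) ∈ K

lemma val_mem_Icc_of_mem_cycInterval {n : ℕ} [NeZero n] {a d x : ZMod n}
    (h : a.val ≤ d.val) (hx : x ∈ cycInterval n a d) : a.val ≤ x.val ∧ x.val ≤ d.val := by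
  obtain ⟨m, hm, rfl⟩ := hx
  rw [ZMod.val_sub h] at hm
  have hd := ZMod.val_lt d
  have hmv : (m : ZMod n).val = m := ZMod.val_cast_of_lt (by omega)
  rw [ZMod.val_add_of_lt (by omega), hmv]
  omega

lemma val_le_or_le_of_mem_cycInterval {n : ℕ} [NeZero n] {a d x : ZMod n}
    (h : a.val < d.val) (hx : x ∈ cycInterval n d a) : x.val ≤ a.val ∨ d.val ≤ x.val := by
  obtain ⟨m, hm, rfl⟩ := hx
  have hd := ZMod.val_lt d
  have hsub : (a - d).val = n - (d.val - a.val) := by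
    have hne : d - a ≠ 0 := fun h0 => by
      rw [sub_eq_zero] at h0
      simp [h0] at h
    have : NeZero (d - a) := ⟨hne⟩
    rw [← neg_sub d a, ZMod.val_neg_of_ne_zero, ZMod.val_sub h.le]
  rw [hsub] at hm
  have hmv : (m : ZMod n).val = m := ZMod.val_cast_of_lt (by omega)
  by_cases hlt : d.val + m < n
  · rw [ZMod.val_add_of_lt (by omega)]
    omega
  · have := ZMod.val_add_val_of_le (a := d) (b := (m : ZMod n)) (by omega)
    omega

/-- Two pairs of a configuration cannot interleave in the linear order of representatives. -/
lemma IsConfiguration.not_crossing {n : ℕ} [NeZero n] {K : Finset (Sym2 (ZMod n))}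
    (hK : IsConfiguration n K) {c a b d : ZMod n} (hca : c.val < a.val) (hab : a.val < b.val)
    (hbd : b.val < d.val) (hcb : s(c, b) ∈ K) : s(a, d) ∉ K := by
  intro had
  rcases hK.2 c b a d hcb had with ⟨hc, -⟩ | ⟨-, hb⟩
  · have := val_mem_Icc_of_mem_cycInterval (by omega) hc
    omega
  · have := val_le_or_le_of_mem_cycInterval (by omega) hb
    omega

lemma IsConfiguration.card_upNeighbors_add_card_downNeighbors {n : ℕ} [NeZero n]
    {K : Finset (Sym2 (ZMod n))} (hK : IsConfiguration n K) (i : ZMod n) :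
    (upNeighbors n K i).card + (downNeighbors n K i).card =
      (univ.filter fun j : ZMod n => s(i, j) ∈ K).card := by
  rw [← card_union_of_disjoint]
  · congr 1
    ext j
    simp only [upNeighbors, downNeighbors, mem_union, mem_filter, mem_univ, true_and]
    constructor
    · tauto
    · intro hj
      have hne : i.val ≠ j.val := fun h => hK.1 _ hj (ZMod.val_injective n h)
      rcases lt_or_gt_of_ne hne with h | h <;> tauto
  · rw [disjoint_left]
    simp only [upNeighbors, downNeighbors, mem_filter, mem_univ, true_and]
    omega

/-- If two finsets have the same cardinality, an element of the first outside the second is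
compensated by an element of the second outside the first. -/
lemma exists_mem_notMem_of_card_eq {α : Type*} {s t : Finset α} (h : s.card = t.card) {b : α}
    (hs : b ∈ s) (ht : b ∉ t) : ∃ d ∈ t, d ∉ s := by
  by_contra! hsub
  exact ht (eq_of_subset_of_card_le hsub h.le ▸ hs)

/-- If two sets of pairs with the same up- and down-degrees agree on all pairs shorter than
`{a, b}`, and the second is a configuration, then it contains `{a, b}` when the first does. -/
lemma IsConfiguration.mem_of_agree_on_shorter {n : ℕ} [NeZero n]
    {K L : Finset (Sym2 (ZMod n))} (hL : IsConfiguration n L)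
    (hup : ∀ i, (upNeighbors n K i).card = (upNeighbors n L i).card)
    (hdown : ∀ i, (downNeighbors n K i).card = (downNeighbors n L i).card)
    {a b : ZMod n} (hab : a.val < b.val)
    (hshort : ∀ x y : ZMod n, x.val < y.val → y.val - x.val < b.val - a.val →
      (s(x, y) ∈ K ↔ s(x, y) ∈ L))
    (h : s(a, b) ∈ K) : s(a, b) ∈ L := by
  by_contra hn
  obtain ⟨d, hdL, hdK⟩ := exists_mem_notMem_of_card_eq (hup a) (b := b)
    (by simp [upNeighbors, hab, h]) (by simp [upNeighbors, hn])
  obtain ⟨c, hcL, hcK⟩ := exists_mem_notMem_of_card_eq (hdown b) (b := a)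
    (by simp [downNeighbors, hab, Sym2.eq_swap (a := b), h])
    (by simp [downNeighbors, Sym2.eq_swap (a := b), hn])
  simp only [upNeighbors, downNeighbors, mem_filter, mem_univ, true_and, not_and,
    Sym2.eq_swap (a := b)] at hdL hdK hcL hcK
  have hbd : b.val < d.val := by
    rcases lt_trichotomy b.val d.val with hlt | heq | hgt
    · exact hlt
    · exact absurd (ZMod.val_injective n heq ▸ hdL.2) hn
    · exact absurd ((hshort a d hdL.1 (by omega)).2 hdL.2) (hdK hdL.1)
  have hca : c.val < a.val := by
    rcases lt_trichotomy c.val a.val with hlt | heq | hgt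
    · exact hlt
    · exact absurd (ZMod.val_injective n heq ▸ hcL.2) hn
    · exact absurd ((hshort c b hcL.1 (by omega)).2 hcL.2) (hcK hcL.1)
  exact hL.not_crossing hca hab hbd hcL.2 hdL.2

/-- A configuration is determined by its up- and down-degrees. -/
lemma IsConfiguration.eq_of_card_neighbors_eq {n : ℕ} [NeZero n]
    {K L : Finset (Sym2 (ZMod n))} (hK : IsConfiguration n K) (hL : IsConfiguration n L)
    (hup : ∀ i, (upNeighbors n K i).card = (upNeighbors n L i).card)
    (hdown : ∀ i, (downNeighbors n K i).card = (downNeighbors n L i).card) : K = L := by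
  have key : ∀ m : ℕ, ∀ a b : ZMod n, a.val < b.val → b.val - a.val = m →
      (s(a, b) ∈ K ↔ s(a, b) ∈ L) := by
    intro m
    induction m using Nat.strong_induction_on with
    | _ m ih =>
      intro a b hab hm
      have hshort : ∀ x y : ZMod n, x.val < y.val → y.val - x.val < b.val - a.val →
          (s(x, y) ∈ K ↔ s(x, y) ∈ L) := fun x y hxy hlt => ih _ (hm ▸ hlt) x y hxy rfl
      exact ⟨hL.mem_of_agree_on_shorter hup hdown hab hshort,
        hK.mem_of_agree_on_shorter (fun i => (hup i).symm) (fun i => (hdown i).symm) hab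
          fun x y hxy hlt => (hshort x y hxy hlt).symm⟩
  ext p
  induction p using Sym2.ind with
  | _ a b =>
    rcases lt_trichotomy a.val b.val with hlt | heq | hgt
    · exact key _ a b hlt rfl
    · have hd : (s(a, b) : Sym2 (ZMod n)).IsDiag := ZMod.val_injective n heq
      exact ⟨fun h => absurd hd (hK.1 _ h), fun h => absurd hd (hL.1 _ h)⟩
    · rw [Sym2.eq_swap]
      exact key _ b a hgt rfl

/-- For `n ≥ 2` and prescribed local degrees `(k_i)_{i ∈ ZMod n}`, the number of
configurations `K` on `ZMod n` with `#{j : {i,j} ∈ K} = k_i` for every `i` is at most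
`2^(k_0 + k_1 + ⋯ + k_{n-1})`. -/
theorem configurations_with_degrees_card_le (n : ℕ) [NeZero n] (hn : 2 ≤ n)
    (k : ZMod n → ℕ) :
    Nat.card {K : Finset (Sym2 (ZMod n)) //
        IsConfiguration n K ∧
        ∀ i : ZMod n, (Finset.univ.filter fun j : ZMod n => s(i, j) ∈ K).card = k i}
      ≤ 2 ^ (∑ i : ZMod n, k i) := by
  have hle : ∀ (K : {K : Finset (Sym2 (ZMod n)) // IsConfiguration n K ∧
      ∀ i : ZMod n, (Finset.univ.filter fun j : ZMod n => s(i, j) ∈ K).card = k i}) (i : ZMod n),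
      (upNeighbors n K.1 i).card + (downNeighbors n K.1 i).card = k i := fun K i =>
    (K.2.1.card_upNeighbors_add_card_downNeighbors i).trans (K.2.2 i)
  let f : {K : Finset (Sym2 (ZMod n)) // IsConfiguration n K ∧
      ∀ i : ZMod n, (Finset.univ.filter fun j : ZMod n => s(i, j) ∈ K).card = k i} →
      ∀ i : ZMod n, Fin (k i + 1) := fun K i =>
    ⟨(upNeighbors n K.1 i).card, by have := hle K i; omega⟩
  have hf : Function.Injective f := by
    intro K L hKL
    have hup : ∀ i, (upNeighbors n K.1 i).card = (upNeighbors n L.1 i).card := fun i =>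
      congrArg Fin.val (congrFun hKL i)
    refine Subtype.ext (K.2.1.eq_of_card_neighbors_eq L.2.1 hup fun i => ?_)
    have := hle K i
    have := hle L i
    have := hup i
    omega
  calc _ ≤ Nat.card (∀ i : ZMod n, Fin (k i + 1)) := Nat.card_le_card_of_injective f hf
    _ = ∏ i : ZMod n, (k i + 1) := by simp
    _ ≤ ∏ i : ZMod n, 2 ^ k i := prod_le_prod' fun i _ => Nat.lt_two_pow_self
    _ = 2 ^ ∑ i : ZMod n, k i := prod_pow_eq_pow_sum _ _ _
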